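/- arXiv:2209.03266 — 2 statements merged into one kernel-verified Lean document; each statement's English description precedes it below -/
import Mathlib

section
/- The infinite binary word 001001 t̄ avoids 7/3-powers, and every infinite binary word that avoids 7/3-powers is greater than or equal to 001001 t̄ in lexicographic order; consequently, for every rational α with 2 < α ≤ 7/3, the word 001001 t̄ is the lexicographically least infinite binary word avoiding α-powers. -/
/-- The Thue–Morse morphism μ : 0 ↦ 01, 1 ↦ 10 (false = 0, true = 1),
extended to finite binary words. -/
def mu (w : List Bool) : List Bool := (w.map (fun b => [b, !b])).flatten

/-- The set S = {ε, 0, 1, 00, 11}. -/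
def S : Set (List Bool) := {[], [false], [true], [false, false], [true, true]}

/-- A finite word `u` is a prefix of the infinite word `w`. -/
def PrefixSeq {α : Type*} (u : List α) (w : ℕ → α) : Prop :=
  ∀ (j : ℕ) (h : j < u.length), u.get ⟨j, h⟩ = w j

/-- A finite word `u` is a factor of the infinite word `w`. -/
def IsFactorSeq (u : List Bool) (w : ℕ → Bool) : Prop :=
  ∃ i : ℕ, ∀ (j : ℕ) (h : j < u.length), u.get ⟨j, h⟩ = w (i + j)

/-- The finite word `u` has period `p` (with `1 ≤ p ≤ |u|`):
`u[i] = u[i+p]` for all `0 ≤ i < |u| - p`. -/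
def HasPeriod (u : List Bool) (p : ℕ) : Prop :=
  1 ≤ p ∧ p ≤ u.length ∧ ∀ i, i + p < u.length → u.getD i false = u.getD (i + p) false

/-- The least period of a finite word. -/
noncomputable def leastPeriod (u : List Bool) : ℕ := sInf {p | HasPeriod u p}

/-- The exponent of a nonempty finite word: its length divided by its least period. -/
noncomputable def exponent (u : List Bool) : ℚ := (u.length : ℚ) / (leastPeriod u : ℚ)

/-- A finite word avoids α-powers: no nonempty factor has exponent ≥ α. -/
def AvoidsPow (a : ℚ) (w : List Bool) : Prop :=
  ∀ u : List Bool, u ≠ [] → u <:+: w → exponent u < a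

/-- A finite word avoids α⁺-powers: no nonempty factor has exponent > α. -/
def AvoidsPowPlus (a : ℚ) (w : List Bool) : Prop :=
  ∀ u : List Bool, u ≠ [] → u <:+: w → exponent u ≤ a

/-- An infinite word avoids α-powers. -/
def AvoidsPowSeq (a : ℚ) (w : ℕ → Bool) : Prop :=
  ∀ u : List Bool, u ≠ [] → IsFactorSeq u w → exponent u < a

/-- An infinite word avoids α⁺-powers. -/
def AvoidsPowPlusSeq (a : ℚ) (w : ℕ → Bool) : Prop :=
  ∀ u : List Bool, u ≠ [] → IsFactorSeq u w → exponent u ≤ a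

/-- An overlap is a word of the form a x a x a, with a a single letter. -/
def IsOverlap (u : List Bool) : Prop :=
  ∃ (a : Bool) (x : List Bool), u = [a] ++ x ++ [a] ++ x ++ [a]

/-- Overlap-freeness for finite words. -/
def OverlapFree (w : List Bool) : Prop := ∀ u : List Bool, u <:+: w → ¬ IsOverlap u

/-- Overlap-freeness for infinite words. -/
def OverlapFreeSeq (w : ℕ → Bool) : Prop := ∀ u : List Bool, IsFactorSeq u w → ¬ IsOverlap u

/-- The Thue–Morse word t = 0110100110010110⋯ : t[n] = 1 iff the number of
ones in the binary expansion of n is odd. -/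
def thueMorse : ℕ → Bool := fun n => (Nat.digits 2 n).count 1 % 2 == 1

/-- The complement t̄ of the Thue–Morse word. -/
def tmbar : ℕ → Bool := fun n => ! thueMorse n

/-- The infinite word obtained by prepending the finite word `u` to `w`. -/
def appendSeq (u : List Bool) (w : ℕ → Bool) : ℕ → Bool :=
  fun n => if h : n < u.length then u.get ⟨n, h⟩ else w (n - u.length)

/-- Lexicographic order on infinite binary words (with 0 < 1). -/
def seqLE (v w : ℕ → Bool) : Prop :=
  v = w ∨ ∃ n : ℕ, (∀ i < n, v i = w i) ∧ v n = false ∧ w n = true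

/-- The word x₀ μ(x₁) μ²(x₂) ⋯ μ^{n-1}(x_{n-1}). -/
def restivoJoin (x : ℕ → List Bool) (n : ℕ) : List Bool :=
  ((List.range n).map (fun i => mu^[i] (x i))).flatten

/-- Finite Restivo words: x₀ μ(x₁) ⋯ μ^t(x_t) with all xᵢ ∈ S. -/
def IsRestivo (w : List Bool) : Prop :=
  ∃ (t : ℕ) (x : ℕ → List Bool), (∀ i ≤ t, x i ∈ S) ∧ w = restivoJoin x (t + 1)

/-- Infinite Restivo words: x₀ μ(x₁) μ²(x₂) ⋯ with all xᵢ ∈ S and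
infinitely many xᵢ nonempty. -/
def IsRestivoSeq (w : ℕ → Bool) : Prop :=
  ∃ x : ℕ → List Bool, (∀ i, x i ∈ S) ∧ (∀ N : ℕ, ∃ i ≥ N, x i ≠ []) ∧
    ∀ n : ℕ, PrefixSeq (restivoJoin x n) w

/-- The infinite word 001001 t̄. -/
def lexLeastWord : ℕ → Bool :=
  appendSeq [false, false, true, false, false, true] tmbar

theorem thueMorse_two_mul (n : ℕ) : thueMorse (2 * n) = thueMorse n := by
  rcases Nat.eq_zero_or_pos n with rfl | hn
  · rfl
  · simp [thueMorse, Nat.digits_def' one_lt_two (show 0 < 2 * n by omega)]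

theorem thueMorse_two_mul_add_one (n : ℕ) : thueMorse (2 * n + 1) = !thueMorse n := by
  have h1 : (2 * n + 1) % 2 = 1 := by omega
  have h2 : (2 * n + 1) / 2 = n := by omega
  simp only [thueMorse, Nat.digits_def' one_lt_two (show 0 < 2 * n + 1 by omega), h1, h2,
    List.count_cons_self]
  rcases Nat.mod_two_eq_zero_or_one ((Nat.digits 2 n).count 1) with h | h <;>
    simp [Nat.add_mod, h]

/-- An infinite word has an overlap of period `p` at position `i`. -/
def OverlapAt (w : ℕ → Bool) (i p : ℕ) : Prop :=
  ∀ j ≤ p, w (i + j) = w (i + j + p)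

theorem not_overlapAt_thueMorse (p : ℕ) (hp : 1 ≤ p) (i : ℕ) : ¬ OverlapAt thueMorse i p := by
  induction p using Nat.strong_induction_on generalizing i with
  | _ p ih =>
    intro h
    rcases Nat.even_or_odd' p with ⟨q, rfl | rfl⟩
    · rcases Nat.even_or_odd' i with ⟨k, rfl | rfl⟩
      · refine ih q (by omega) (by omega) k fun j hj => ?_
        have := h (2 * j) (by omega)
        rwa [show 2 * k + 2 * j + 2 * q = 2 * (k + j + q) by ring, ← mul_add,
          thueMorse_two_mul, thueMorse_two_mul] at this
      · refine ih q (by omega) (by omega) k fun j hj => ?_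
        have := h (2 * j) (by omega)
        rwa [show 2 * k + 1 + 2 * j + 2 * q = 2 * (k + j + q) + 1 by ring,
          show 2 * k + 1 + 2 * j = 2 * (k + j) + 1 by ring,
          thueMorse_two_mul_add_one, thueMorse_two_mul_add_one, Bool.not_inj_iff] at this
    · have alt : ∀ j < 2 * q + 1, thueMorse (i + j + 1) = !thueMorse (i + j) := by
        intro j hj
        have h1 := h j (by omega)
        have h2 := h (j + 1) (by omega)
        rcases Nat.even_or_odd' (i + j) with ⟨k, hk | hk⟩
        · rw [hk, thueMorse_two_mul_add_one, thueMorse_two_mul]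
        · rw [show i + j + (2 * q + 1) = 2 * (k + q + 1) by omega, thueMorse_two_mul] at h1
          rw [show i + (j + 1) + (2 * q + 1) = 2 * (k + q + 1) + 1 by omega,
            thueMorse_two_mul_add_one] at h2
          rw [add_assoc, h2, h1]
      have alt' : ∀ j ≤ q, thueMorse (i + 2 * j) = thueMorse i := by
        intro j
        induction j with
        | zero => simp
        | succ j ihj =>
          intro hj
          have h1 := alt (2 * j) (by omega)
          have h2 := alt (2 * j + 1) (by omega)
          rw [← add_assoc] at h2
          rw [show i + 2 * (j + 1) = i + 2 * j + 1 + 1 by ring, h2, h1, Bool.not_not,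
            ihj (by omega)]
      have h0 := h 0 (by omega)
      have h1 := alt (2 * q) (by omega)
      rw [alt' q le_rfl] at h1
      rw [add_zero, ← add_assoc, h1] at h0
      simp at h0

theorem thueMorse_two_pow_add (a m : ℕ) (hm : m < 2 ^ a) :
    thueMorse (2 ^ a + m) = !thueMorse m := by
  induction a generalizing m with
  | zero =>
    obtain rfl : m = 0 := by simpa using hm
    simpa using thueMorse_two_mul_add_one 0
  | succ a ih =>
    rw [pow_succ] at hm ⊢
    rcases Nat.even_or_odd' m with ⟨k, rfl | rfl⟩
    · rw [show 2 ^ a * 2 + 2 * k = 2 * (2 ^ a + k) by ring, thueMorse_two_mul,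
        thueMorse_two_mul, ih k (by omega)]
    · rw [show 2 ^ a * 2 + (2 * k + 1) = 2 * (2 ^ a + k) + 1 by ring,
        thueMorse_two_mul_add_one, thueMorse_two_mul_add_one, ih k (by omega)]

theorem thueMorse_two_mul_four_pow_sub_one (c : ℕ) : thueMorse (2 * 4 ^ c - 1) = true := by
  induction c with
  | zero => simp [thueMorse]
  | succ c ih =>
    have : 0 < 4 ^ c := by positivity
    rw [show 2 * 4 ^ (c + 1) - 1 = 2 * (2 * (2 * 4 ^ c - 1) + 1) + 1 by rw [pow_succ]; omega,
      thueMorse_two_mul_add_one, thueMorse_two_mul_add_one, ih]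
    rfl

theorem lexLeastWord_add_six (n : ℕ) : lexLeastWord (n + 6) = !thueMorse n := by
  simp [lexLeastWord, appendSeq, tmbar]

theorem lexLeastWord_initial_letters : lexLeastWord 0 = false ∧ lexLeastWord 1 = false ∧
    lexLeastWord 2 = true ∧ lexLeastWord 3 = false ∧ lexLeastWord 4 = false ∧
    lexLeastWord 5 = true := by
  simp [lexLeastWord, appendSeq]

/-- Every prefix of `01001 t̄` is a factor of the Thue–Morse word. -/
theorem lexLeastWord_add_one (c n : ℕ) (hn : n < 5 + 32 * 4 ^ c) :
    lexLeastWord (n + 1) = thueMorse (32 * 4 ^ c - 5 + n) := by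
  have hpos : 0 < 4 ^ c := by positivity
  obtain ⟨-, x1, x2, x3, x4, x5⟩ := lexLeastWord_initial_letters
  have hq := thueMorse_two_mul_four_pow_sub_one c
  have hA : 32 * 4 ^ c = 16 * (2 * 4 ^ c - 1) + 16 := by omega
  by_cases h5 : n < 5
  · generalize 2 * 4 ^ c - 1 = q at hq hA
    rw [hA, show 16 * q + 16 - 5 + n = 16 * q + 11 + n by omega]
    interval_cases n
    · rw [x1, show 16 * q + 11 + 0 = 2 * (2 * (2 * (2 * q + 1)) + 1) + 1 by ring]
      simp [thueMorse_two_mul, thueMorse_two_mul_add_one, hq]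
    · rw [x2, show 16 * q + 11 + 1 = 2 * (2 * (2 * (2 * q + 1) + 1)) by ring]
      simp [thueMorse_two_mul, thueMorse_two_mul_add_one, hq]
    · rw [x3, show 16 * q + 11 + 2 = 2 * (2 * (2 * (2 * q + 1) + 1)) + 1 by ring]
      simp [thueMorse_two_mul, thueMorse_two_mul_add_one, hq]
    · rw [x4, show 16 * q + 11 + 3 = 2 * (2 * (2 * (2 * q + 1) + 1) + 1) by ring]
      simp [thueMorse_two_mul, thueMorse_two_mul_add_one, hq]
    · rw [x5, show 16 * q + 11 + 4 = 2 * (2 * (2 * (2 * q + 1) + 1) + 1) + 1 by ring]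
      simp [thueMorse_two_mul_add_one, hq]
  · obtain ⟨m, rfl⟩ : ∃ m, n = m + 5 := ⟨n - 5, by omega⟩
    have e : 32 * 4 ^ c = 2 ^ (2 * c + 5) := by rw [pow_add, pow_mul]; norm_num; ring
    rw [lexLeastWord_add_six, ← thueMorse_two_pow_add (2 * c + 5) m (by omega)]
    congr 1
    omega

theorem not_overlapAt_lexLeastWord_zero (p : ℕ) (hp : 1 ≤ p) : ¬ OverlapAt lexLeastWord 0 p := by
  intro h
  obtain ⟨x0, x1, x2, x3, x4, x5⟩ := lexLeastWord_initial_letters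
  have x6 : lexLeastWord 6 = true := lexLeastWord_add_six 0
  have eq : ∀ j ≤ p, lexLeastWord j = lexLeastWord (j + p) := by simpa [OverlapAt] using h
  by_cases hp6 : p < 6
  · interval_cases p
    · simpa [x1, x2] using eq 1 (by omega)
    · simpa [x0, x2] using eq 0 (by omega)
    · simpa [x3, x6] using eq 3 (by omega)
    · simpa [x1, x5] using eq 1 (by omega)
    · simpa [x0, x5] using eq 0 (by omega)
  · have e0 := eq 0 (by omega)
    have e1 := eq 1 (by omega)
    have e3 := eq 3 (by omega)
    have e4 := eq 4 (by omega)
    rcases Nat.even_or_odd' p with ⟨q, rfl | rfl⟩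
    · rw [show 0 + 2 * q = 2 * (q - 3) + 6 by omega, lexLeastWord_add_six,
        thueMorse_two_mul, x0] at e0
      rw [show 1 + 2 * q = 2 * (q - 3) + 1 + 6 by omega, lexLeastWord_add_six,
        thueMorse_two_mul_add_one, x1, ← e0] at e1
      simp at e1
    · rw [show 3 + (2 * q + 1) = 2 * (q - 1) + 6 by omega, lexLeastWord_add_six,
        thueMorse_two_mul, x3] at e3
      rw [show 4 + (2 * q + 1) = 2 * (q - 1) + 1 + 6 by omega, lexLeastWord_add_six,
        thueMorse_two_mul_add_one, x4, ← e3] at e4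
      simp at e4

theorem not_overlapAt_lexLeastWord (i p : ℕ) (hp : 1 ≤ p) : ¬ OverlapAt lexLeastWord i p := by
  rcases i with _ | i
  · exact not_overlapAt_lexLeastWord_zero p hp
  · intro h
    have hc : i + 2 * p < 4 ^ (i + 2 * p) := Nat.lt_pow_self (by norm_num)
    refine not_overlapAt_thueMorse p hp (32 * 4 ^ (i + 2 * p) - 5 + i) fun j hj => ?_
    have := h j hj
    rw [show i + 1 + j + p = i + j + p + 1 by ring, show i + 1 + j = i + j + 1 by ring,
      lexLeastWord_add_one (i + 2 * p) _ (by omega),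
      lexLeastWord_add_one (i + 2 * p) _ (by omega)] at this
    simpa only [add_assoc] using this

theorem hasPeriod_leastPeriod {u : List Bool} (hu : u ≠ []) : HasPeriod u (leastPeriod u) :=
  Nat.sInf_mem (s := {p | HasPeriod u p})
    ⟨u.length, List.length_pos_iff.mpr hu, le_rfl, fun i hi => by omega⟩

theorem avoidsPowSeq_of_forall_not_overlapAt {w : ℕ → Bool}
    (hw : ∀ i p, 1 ≤ p → ¬ OverlapAt w i p) {a : ℚ} (ha : 2 < a) : AvoidsPowSeq a w := by
  rintro u hu ⟨i, hi⟩
  obtain ⟨h1, -, hper⟩ := hasPeriod_leastPeriod hu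
  by_contra! hcon
  have h2 : (2 : ℚ) < exponent u := ha.trans_le hcon
  have hpos : (0 : ℚ) < leastPeriod u := by exact_mod_cast h1
  rw [exponent, lt_div_iff₀ hpos] at h2
  have hlen : 2 * leastPeriod u < u.length := by exact_mod_cast h2
  refine hw i _ h1 fun j hj => ?_
  have := hper j (by omega)
  rw [List.getD_eq_getElem _ _ (by omega), List.getD_eq_getElem _ _ (by omega)] at this
  rw [add_assoc, ← hi j (by omega), ← hi (j + leastPeriod u) (by omega)]
  simpa using this

/-- An infinite word has no factor of period `p` and length at least `7p/3`. -/
def SevenThirdsFree (w : ℕ → Bool) : Prop :=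
  ∀ i p, 1 ≤ p → ¬ ∀ j, 3 * j < 4 * p → w (i + j) = w (i + j + p)

theorem AvoidsPowSeq.sevenThirdsFree {w : ℕ → Bool} (hw : AvoidsPowSeq (7 / 3) w) :
    SevenThirdsFree w := by
  intro i p hp h
  let u : List Bool := List.ofFn fun j : Fin ((7 * p + 2) / 3) => w (i + j)
  have hlen : u.length = (7 * p + 2) / 3 := by simp [u]
  have hu : u ≠ [] := List.length_pos_iff.mp (by omega)
  have hper : HasPeriod u p := by
    refine ⟨hp, by omega, fun j hj => ?_⟩
    rw [List.getD_eq_getElem _ _ (by omega), List.getD_eq_getElem _ _ (by omega)]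
    simpa [u, add_assoc] using h j (by omega)
  have hlt := hw u hu ⟨i, fun j hj => by simp [u]⟩
  have hle : leastPeriod u ≤ p := Nat.sInf_le hper
  have hpos : (0 : ℚ) < leastPeriod u := by exact_mod_cast (hasPeriod_leastPeriod hu).1
  rw [exponent, div_lt_iff₀ hpos] at hlt
  have h3 : 3 * u.length < 7 * leastPeriod u := by
    have : (3 : ℚ) * u.length < 7 * leastPeriod u := by linarith
    exact_mod_cast this
  omega

namespace SevenThirdsFree

variable {w : ℕ → Bool}

theorem shift (hw : SevenThirdsFree w) (k : ℕ) : SevenThirdsFree fun n => w (k + n) := by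
  intro i p hp h
  exact hw (k + i) p hp fun j hj => by simpa [add_assoc] using h j hj

theorem not_cube (hw : SevenThirdsFree w) (i : ℕ) :
    ¬ (w i = w (i + 1) ∧ w (i + 1) = w (i + 2)) := by
  rintro ⟨h0, h1⟩
  refine hw i 1 le_rfl fun j hj => ?_
  have : j < 2 := by omega
  interval_cases j <;> assumption

theorem not_period_two (hw : SevenThirdsFree w) (i : ℕ) :
    ¬ (w i = w (i + 2) ∧ w (i + 1) = w (i + 3) ∧ w (i + 2) = w (i + 4)) := by
  rintro ⟨h0, h1, h2⟩
  refine hw i 2 (by omega) fun j hj => ?_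
  have : j < 3 := by omega
  interval_cases j <;> assumption

theorem not_period_three (hw : SevenThirdsFree w) (i : ℕ) :
    ¬ (w i = w (i + 3) ∧ w (i + 1) = w (i + 4) ∧ w (i + 2) = w (i + 5) ∧
      w (i + 3) = w (i + 6)) := by
  rintro ⟨h0, h1, h2, h3⟩
  refine hw i 3 (by omega) fun j hj => ?_
  have : j < 4 := by omega
  interval_cases j <;> assumption

/-- Two consecutive blocks `01` or `10` are followed by a third one. -/
theorem block_succ (hw : SevenThirdsFree w) (i : ℕ) (h0 : w (i + 1) = !w i)
    (h1 : w (i + 3) = !w (i + 2)) : w (i + 5) = !w (i + 4) := by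
  have c2 := hw.not_cube (i + 3)
  have c3 := hw.not_cube (i + 4)
  have p2 := hw.not_period_two i
  have p3 := hw.not_period_three i
  simp only [add_assoc, Nat.reduceAdd] at c2 c3 p2 p3
  revert h0 h1 c2 c3 p2 p3
  generalize w i = a0
  generalize w (i + 1) = a1
  generalize w (i + 2) = a2
  generalize w (i + 3) = a3
  generalize w (i + 4) = a4
  generalize w (i + 5) = a5
  generalize w (i + 6) = a6
  revert a0 a1 a2 a3 a4 a5 a6
  decide

theorem blocks (hw : SevenThirdsFree w) (h0 : w 1 = !w 0) (h1 : w 3 = !w 2) (k : ℕ) :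
    w (2 * k + 1) = !w (2 * k) := by
  induction k using Nat.twoStepInduction with
  | zero => exact h0
  | one => exact h1
  | more k ih0 ih1 => exact hw.block_succ (2 * k) ih0 ih1

/-- Desubstitution by the Thue–Morse morphism preserves avoidance of `7/3`-powers. -/
theorem desubstitute (hw : SevenThirdsFree w) (hb : ∀ k, w (2 * k + 1) = !w (2 * k)) :
    SevenThirdsFree fun n => w (2 * n) := by
  intro i p hp h
  refine hw (2 * i) (2 * p) (by omega) fun j hj => ?_
  rcases Nat.even_or_odd' j with ⟨k, rfl | rfl⟩
  · simpa [mul_add] using h k (by omega)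
  · have := h k (by omega)
    rw [show 2 * i + (2 * k + 1) + 2 * p = 2 * (i + k + p) + 1 by ring,
      show 2 * i + (2 * k + 1) = 2 * (i + k) + 1 by ring, hb, hb]
    exact congrArg _ this

/-- A word avoiding `7/3`-powers that begins with `10` is at least `t̄`. -/
theorem not_lt_tmbar (n : ℕ) (w : ℕ → Bool) (hw : SevenThirdsFree w) (h0 : w 0 = true)
    (h1 : w 1 = false) (heq : ∀ i < n, w i = tmbar i) (hn : w n = false) : tmbar n = false := by
  induction n using Nat.strong_induction_on generalizing w with
  | _ n ih =>
    by_contra hcon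
    have t1 : tmbar 1 = false := by decide
    have t2 : tmbar 2 = false := by decide
    have n0 : n ≠ 0 := by rintro rfl; simp [h0] at hn
    have n1 : n ≠ 1 := by rintro rfl; exact hcon t1
    have n2 : n ≠ 2 := by rintro rfl; exact hcon t2
    have h2 : w 2 = false := (heq 2 (by omega)).trans t2
    have h3 : w 3 = true := by
      have := hw.not_cube 1
      simpa [h1, h2] using this
    have hb := hw.blocks (by simp [h0, h1]) (by simp [h2, h3])
    rcases Nat.even_or_odd' n with ⟨k, rfl | rfl⟩
    · refine hcon ?_
      have := ih k (by omega) (fun n => w (2 * n)) (hw.desubstitute hb) h0 h2 (fun i hi => ?_) hn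
      · rw [tmbar, thueMorse_two_mul]; exact this
      · have := heq (2 * i) (by omega)
        rwa [tmbar, thueMorse_two_mul] at this
    · have := heq (2 * k) (by omega)
      rw [hb, this, tmbar, thueMorse_two_mul] at hn
      rw [tmbar, thueMorse_two_mul_add_one] at hcon
      exact hcon hn

theorem lexLeastWord_not_gt (hw : SevenThirdsFree w) (n : ℕ)
    (heq : ∀ i < n, w i = lexLeastWord i) (hn : w n = false) : lexLeastWord n = false := by
  obtain ⟨x0, x1, x2, x3, x4, x5⟩ := lexLeastWord_initial_letters
  by_contra hcon
  have c0 := hw.not_cube 0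
  have c3 := hw.not_cube 3
  have p3 := hw.not_period_three 0
  simp only [zero_add, Nat.reduceAdd] at c0 c3 p3
  have n0 : n ≠ 0 := by rintro rfl; exact hcon x0
  have w0 : w 0 = false := (heq 0 (by omega)).trans x0
  have n1 : n ≠ 1 := by rintro rfl; exact hcon x1
  have w1 : w 1 = false := (heq 1 (by omega)).trans x1
  have n2 : n ≠ 2 := by rintro rfl; simp [w0, w1, hn] at c0
  have w2 : w 2 = true := (heq 2 (by omega)).trans x2
  have n3 : n ≠ 3 := by rintro rfl; exact hcon x3
  have w3 : w 3 = false := (heq 3 (by omega)).trans x3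
  have n4 : n ≠ 4 := by rintro rfl; exact hcon x4
  have w4 : w 4 = false := (heq 4 (by omega)).trans x4
  have n5 : n ≠ 5 := by rintro rfl; simp [w3, w4, hn] at c3
  have w5 : w 5 = true := (heq 5 (by omega)).trans x5
  have w6 : w 6 = true := by simpa [w0, w1, w2, w3, w4, w5] using p3
  have n6 : n ≠ 6 := by rintro rfl; simp [w6] at hn
  have x7 : lexLeastWord 7 = false := lexLeastWord_add_six 1
  have w7 : w 7 = false := by
    rcases eq_or_ne n 7 with rfl | n7
    · exact hn
    · exact (heq 7 (by omega)).trans x7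
  obtain ⟨m, rfl⟩ : ∃ m, n = 6 + m := ⟨n - 6, by omega⟩
  refine hcon ?_
  have hx : ∀ i, lexLeastWord (6 + i) = tmbar i := fun i => by
    rw [add_comm, lexLeastWord_add_six, tmbar]
  rw [hx]
  exact not_lt_tmbar m _ (hw.shift 6) w6 w7 (fun i hi => by rw [heq _ (by omega), hx]) hn

theorem seqLE_lexLeastWord (hw : SevenThirdsFree w) : seqLE lexLeastWord w := by
  by_cases h : lexLeastWord = w
  · exact Or.inl h
  · right
    have hex : ∃ n, lexLeastWord n ≠ w n := Function.ne_iff.mp h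
    classical
    have hmin : ∀ i < Nat.find hex, lexLeastWord i = w i := fun i hi => by
      simpa using Nat.find_min hex hi
    have hne := Nat.find_spec hex
    refine ⟨Nat.find hex, hmin, ?_⟩
    cases hwn : w (Nat.find hex) with
    | false =>
      exact absurd (hw.lexLeastWord_not_gt _ (fun i hi => (hmin i hi).symm) hwn)
        (by rwa [hwn] at hne)
    | true =>
      rw [hwn] at hne
      simpa using hne

end SevenThirdsFree

/-- 001001 t̄ avoids 7/3-powers and is lexicographically least among infinite
binary words avoiding 7/3-powers; consequently it is the lexicographically
least infinite binary word avoiding α-powers, for every rational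
2 < α ≤ 7/3. -/
theorem lexLeast_sevenThirds :
    AvoidsPowSeq (7/3) lexLeastWord ∧
    (∀ w : ℕ → Bool, AvoidsPowSeq (7/3) w → seqLE lexLeastWord w) ∧
    ∀ a : ℚ, 2 < a → a ≤ 7/3 →
      AvoidsPowSeq a lexLeastWord ∧
      ∀ w : ℕ → Bool, AvoidsPowSeq a w → seqLE lexLeastWord w := by
  refine ⟨avoidsPowSeq_of_forall_not_overlapAt not_overlapAt_lexLeastWord (by norm_num),
    fun w hw => hw.sevenThirdsFree.seqLE_lexLeastWord, fun a ha ha' => ⟨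
      avoidsPowSeq_of_forall_not_overlapAt not_overlapAt_lexLeastWord ha, fun w hw => ?_⟩⟩
  have : AvoidsPowSeq (7 / 3) w := fun u hu hf => (hw u hu hf).trans_le ha'
  exact this.sevenThirdsFree.seqLE_lexLeastWord
end

section
/- For every integer i ≥ 1, the word (11)·μ(11)·μ²(11)⋯μ^{i-1}(11)·μ^i(1)·μ^{i+2}(0) is a finite Restivo word of length 7·2^i − 2 that contains a square of order 2^i and contains no square of order greater than 2^i. Hence the bound that every finite Restivo word of length l > 8 contains a square of order ≥ (l+2)/7 is best possible for arbitrarily large lengths. -/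
/-- The word (11) μ(11) ⋯ μ^{i-1}(11) μ^i(1) μ^{i+2}(0). -/
def W9 (i : ℕ) : List Bool :=
  ((List.range i).map (fun j => mu^[j] [true, true])).flatten ++
    mu^[i] [true] ++ mu^[i + 2] [false]

theorem mu_cons (b : Bool) (w : List Bool) : mu (b :: w) = b :: (!b) :: mu w := by
  simp [mu]

theorem mu_append (u v : List Bool) : mu (u ++ v) = mu u ++ mu v := by
  simp [mu]

theorem length_mu (w : List Bool) : (mu w).length = 2 * w.length := by
  induction w with
  | nil => rfl
  | cons b w ih => simp [mu_cons, ih]; ring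

theorem mu_flatten (L : List (List Bool)) : mu L.flatten = (L.map mu).flatten := by
  induction L with
  | nil => rfl
  | cons u L ih => simp [mu_append, ih]

theorem getD_mu (w : List Bool) (k : ℕ) (hk : k < w.length) :
    (mu w).getD (2 * k) false = w.getD k false ∧
      (mu w).getD (2 * k + 1) false = !w.getD k false := by
  induction w generalizing k with
  | nil => simp at hk
  | cons b w ih =>
    rw [mu_cons]
    cases k with
    | zero => simp
    | succ k => simpa [mul_add] using ih k (by simpa using hk)

theorem W9_succ (i : ℕ) : W9 (i + 1) = true :: true :: mu (W9 i) := by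
  unfold W9
  rw [List.range_succ_eq_map, mu_append, mu_append, mu_flatten]
  simp [-List.range_map_iterate, Function.iterate_succ_apply', Function.comp_def]

theorem length_W9_add_two (i : ℕ) : (W9 i).length + 2 = 7 * 2 ^ i := by
  induction i with
  | zero => rfl
  | succ i ih => simp only [W9_succ, List.length_cons, length_mu, pow_succ]; omega

theorem isRestivo_W9 (i : ℕ) : IsRestivo (W9 i) := by
  refine ⟨i + 2, fun j => if j < i then [true, true] else if j = i then [true]
    else if j = i + 1 then [] else [false], ?_, ?_⟩
  · intro j _
    simp only [S]
    split_ifs <;> simp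
  · have hnil : ∀ n, mu^[n] [] = [] := fun n => Function.iterate_fixed rfl n
    have hmap : (List.range i).map (fun j => mu^[j] (if j < i then [true, true]
        else if j = i then [true] else if j = i + 1 then [] else [false])) =
        (List.range i).map (fun j => mu^[j] [true, true]) :=
      List.map_congr_left fun j hj => by rw [if_pos (List.mem_range.1 hj)]
    unfold W9 restivoJoin
    rw [List.range_succ, List.range_succ, List.range_succ]
    simp only [List.map_append, List.flatten_append, hmap]
    simp [hnil]

theorem exists_square_W9 (i : ℕ) :
    ∃ x : List Bool, x.length = 2 ^ i ∧ (x ++ x) <:+: W9 i := by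
  induction i with
  | zero => exact ⟨[true], rfl, [true, false], [false], rfl⟩
  | succ i ih =>
    obtain ⟨x, hx, u, v, h⟩ := ih
    refine ⟨mu x, by rw [length_mu, hx, pow_succ, mul_comm], true :: true :: mu u, mu v, ?_⟩
    rw [W9_succ, ← h]
    simp [mu_append]

/-- The word `w` contains a square of order `n` starting at position `s`. -/
def SquareAt (w : List Bool) (n s : ℕ) : Prop :=
  s + 2 * n ≤ w.length ∧ ∀ p, s ≤ p → p < s + n → w.getD p false = w.getD (p + n) false

theorem exists_squareAt_of_infix {x w : List Bool} (h : (x ++ x) <:+: w) :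
    ∃ s, SquareAt w x.length s := by
  obtain ⟨u, v, rfl⟩ := h
  refine ⟨u.length, by simp; omega, fun p hp hpx => ?_⟩
  obtain ⟨q, rfl⟩ := Nat.exists_eq_add_of_le hp
  have hq : q < x.length := by omega
  simp [List.getD_eq_getElem?_getD, List.getElem?_append, hq, add_assoc]

theorem getD_cons_cons_mu (w : List Bool) (k : ℕ) (hk : k < w.length) :
    (true :: true :: mu w).getD (2 * k + 2) false = w.getD k false ∧
      (true :: true :: mu w).getD (2 * k + 3) false = !w.getD k false := by
  simpa using getD_mu w k hk

theorem exists_squareAt_of_even {w : List Bool} {m s : ℕ} (hm : 1 ≤ m)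
    (h : SquareAt (true :: true :: mu w) (2 * m) s) : ∃ s', SquareAt w m s' := by
  obtain ⟨hlen, hsq⟩ := h
  have hf := getD_cons_cons_mu w
  have h0 : (true :: true :: mu w).getD 0 false = true := rfl
  have h1 : (true :: true :: mu w).getD 1 false = true := rfl
  simp only [List.length_cons, length_mu] at hlen
  generalize true :: true :: mu w = z at *
  obtain ⟨a, rfl | rfl⟩ := Nat.even_or_odd' s
  · rcases a with _ | a
    · have e0 := hsq 0 (by omega) (by omega)
      have e1 := hsq 1 (by omega) (by omega)
      obtain ⟨p0, p1⟩ := hf (m - 1) (by omega)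
      rw [show 2 * (m - 1) + 2 = 0 + 2 * m by omega] at p0
      rw [show 2 * (m - 1) + 3 = 1 + 2 * m by omega] at p1
      grind
    · refine ⟨a, by omega, fun q hq hq' => ?_⟩
      rw [← (hf q (by omega)).1, ← (hf (q + m) (by omega)).1, hsq _ (by omega) (by omega)]
      congr 1; ring
  · rcases a with _ | a
    · refine ⟨0, by omega, fun q hq hq' => ?_⟩
      rw [← (hf q (by omega)).1, ← (hf (q + m) (by omega)).1, hsq _ (by omega) (by omega)]
      congr 1; ring
    · refine ⟨a, by omega, fun q hq hq' => ?_⟩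
      have e := hsq (2 * q + 3) (by omega) (by omega)
      rw [show 2 * q + 3 + 2 * m = 2 * (q + m) + 3 by ring, (hf q (by omega)).2,
        (hf (q + m) (by omega)).2] at e
      simpa using e

/-- The word `w` does not contain `000`. -/
def NoThreeZeros (w : List Bool) : Prop :=
  ∀ p, p + 2 < w.length →
    w.getD p false = true ∨ w.getD (p + 1) false = true ∨ w.getD (p + 2) false = true

theorem order_lt_five_of_odd {w : List Bool} {n s : ℕ} (hn : Odd n)
    (hw : w.getD 0 false = true) (hw0 : NoThreeZeros w)
    (h : SquareAt (true :: true :: mu w) n s) : n < 5 := by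
  by_contra! hn5
  obtain ⟨m, rfl⟩ := hn
  obtain ⟨hlen, hsq⟩ := h
  have hf := getD_cons_cons_mu w
  have h1 : (true :: true :: mu w).getD 1 false = true := rfl
  simp only [List.length_cons, length_mu] at hlen
  generalize true :: true :: mu w = z at *
  have h2 : z.getD 2 false = true := by rw [(hf 0 (by omega)).1, hw]
  have pair : ∀ k, k < w.length → z.getD (2 * k + 3) false = !z.getD (2 * k + 2) false :=
    fun k hk => by rw [(hf k hk).1, (hf k hk).2]
  have alt : ∀ p, 1 ≤ p → s ≤ p → p + 1 < s + (2 * m + 1) →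
      z.getD (p + 1) false = !z.getD p false := by
    intro p hp hsp hps
    obtain ⟨k, rfl | rfl⟩ := Nat.even_or_odd' p
    · have := pair (k - 1) (by omega)
      rwa [show 2 * (k - 1) + 3 = 2 * k + 1 by omega,
        show 2 * (k - 1) + 2 = 2 * k by omega] at this
    · rw [hsq _ hsp (by omega), hsq _ (by omega) hps]
      have := pair (k + m) (by omega)
      rwa [show 2 * (k + m) + 3 = 2 * k + 1 + 1 + (2 * m + 1) by ring,
        show 2 * (k + m) + 2 = 2 * k + 1 + (2 * m + 1) by ring] at this
  rcases Nat.lt_or_ge s 2 with hs | hs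
  · have := alt 1 le_rfl (by omega) (by omega)
    rw [h1] at this
    simp_all
  have per : ∀ j, 2 * j ≤ 2 * m → z.getD (s + 2 * j) false = z.getD s false := by
    intro j
    induction j with
    | zero => simp
    | succ j ih =>
      intro hj
      rw [show s + 2 * (j + 1) = s + 2 * j + 1 + 1 by ring, alt _ (by omega) (by omega) (by omega),
        alt _ (by omega) (by omega) (by omega), ih (by omega), Bool.not_not]
  have hmid : z.getD (s + (2 * m + 1)) false = z.getD (s + 2 * m) false := by
    rw [← hsq s le_rfl (by omega), per m le_rfl]
  obtain ⟨a, rfl | rfl⟩ := Nat.even_or_odd' s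
  · have := pair (a + m - 1) (by omega)
    rw [show 2 * (a + m - 1) + 3 = 2 * a + (2 * m + 1) by omega,
      show 2 * (a + m - 1) + 2 = 2 * a + 2 * m by omega, hmid] at this
    simp at this
  · obtain ⟨a, rfl⟩ := Nat.exists_eq_add_of_le (show 1 ≤ a by omega)
    have p2 := per 1 (by omega)
    have p4 := per 2 (by omega)
    cases hc : z.getD (2 * (1 + a) + 1) false with
    | true =>
      have q0 := (hf a (by omega)).2
      have q1 := (hf (a + 1) (by omega)).2
      have q2 := (hf (a + 2) (by omega)).2
      rw [show 2 * a + 3 = 2 * (1 + a) + 1 by ring, hc] at q0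
      rw [show 2 * (a + 1) + 3 = 2 * (1 + a) + 1 + 2 * 1 by ring, p2, hc] at q1
      rw [show 2 * (a + 2) + 3 = 2 * (1 + a) + 1 + 2 * 2 by ring, p4, hc] at q2
      have := hw0 a (by omega)
      simp_all
    | false =>
      have e0 := hsq (2 * (1 + a) + 1) (by omega) (by omega)
      have e2 := hsq (2 * (1 + a) + 1 + 2 * 1) (by omega) (by omega)
      have e4 := hsq (2 * (1 + a) + 1 + 2 * 2) (by omega) (by omega)
      have q0 := (hf (a + m + 1) (by omega)).1
      have q1 := (hf (a + m + 1 + 1) (by omega)).1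
      have q2 := (hf (a + m + 1 + 2) (by omega)).1
      rw [show 2 * (a + m + 1) + 2 = 2 * (1 + a) + 1 + (2 * m + 1) by ring, ← e0, hc] at q0
      rw [show 2 * (a + m + 1 + 1) + 2 = 2 * (1 + a) + 1 + 2 * 1 + (2 * m + 1) by ring,
        ← e2, p2, hc] at q1
      rw [show 2 * (a + m + 1 + 2) + 2 = 2 * (1 + a) + 1 + 2 * 2 + (2 * m + 1) by ring,
        ← e4, p4, hc] at q2
      have := hw0 (a + m + 1) (by omega)
      simp only [← q0, ← q1, ← q2, Bool.false_eq_true, or_self] at this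

theorem noThreeZeros_cons_cons_mu (w : List Bool) : NoThreeZeros (true :: true :: mu w) := by
  intro p hp
  rcases p with _ | _ | p
  · simp
  · simp
  simp only [List.length_cons, length_mu] at hp
  have hf := getD_cons_cons_mu w
  obtain ⟨k, rfl | rfl⟩ := Nat.even_or_odd' p
  · obtain ⟨h0, h1⟩ := hf k (by omega)
    grind
  · obtain ⟨h0, h1⟩ := hf (k + 1) (by omega)
    grind

theorem squareAt_W9_one {n s : ℕ} (h : SquareAt (W9 1) n s) : n ≤ 2 := by
  obtain ⟨hlen, hsq⟩ := h
  have hW : W9 1 = [true, true, true, false, false, true, true, false, true, false, false, true] :=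
    rfl
  rw [hW] at hlen hsq
  by_contra! hn
  simp only [List.length_cons, List.length_nil] at hlen
  have e0 := hsq s (by omega) (by omega)
  have e1 := hsq (s + 1) (by omega) (by omega)
  have e2 := hsq (s + 2) (by omega) (by omega)
  have hn' : n ≤ 6 := by omega
  have hs' : s ≤ 6 := by omega
  have e3 : 4 ≤ n → _ := fun h4 => hsq (s + 3) (by omega) (by omega)
  clear hsq
  interval_cases n <;> interval_cases s <;> simp_all

theorem order_le_of_squareAt_W9 (i : ℕ) (hi : 1 ≤ i) {n s : ℕ} (h : SquareAt (W9 i) n s) :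
    n ≤ 2 ^ i := by
  induction i, hi using Nat.le_induction generalizing n s with
  | base => simpa using squareAt_W9_one h
  | succ i hi ih =>
    rw [W9_succ] at h
    obtain ⟨m, rfl | rfl⟩ := Nat.even_or_odd' n
    · rcases Nat.eq_zero_or_pos m with rfl | hm
      · simp
      · obtain ⟨s', hs'⟩ := exists_squareAt_of_even hm h
        have := ih hs'
        rw [pow_succ]; omega
    · obtain ⟨j, rfl⟩ := Nat.exists_eq_add_of_le' hi
      rw [W9_succ j] at h
      have := order_lt_five_of_odd ⟨m, rfl⟩ rfl (noThreeZeros_cons_cons_mu _) h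
      have : 1 ≤ 2 ^ j := Nat.one_le_two_pow
      rw [pow_succ, pow_succ]; omega

/-- For every i ≥ 1, the word (11)μ(11)⋯μ^{i-1}(11)μ^i(1)μ^{i+2}(0) is a
finite Restivo word of length 7·2^i − 2 whose largest square has order
exactly 2^i; hence the (l+2)/7 bound is sharp for arbitrarily large lengths. -/
theorem restivo_square_bound_sharp (i : ℕ) (hi : 1 ≤ i) :
    IsRestivo (W9 i) ∧ (W9 i).length = 7 * 2 ^ i - 2 ∧
    (∃ x : List Bool, x.length = 2 ^ i ∧ (x ++ x) <:+: W9 i) ∧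
    ∀ x : List Bool, x ≠ [] → (x ++ x) <:+: W9 i → x.length ≤ 2 ^ i := by
  have := length_W9_add_two i
  exact ⟨isRestivo_W9 i, by omega, exists_square_W9 i, fun x _ hx =>
    (exists_squareAt_of_infix hx).elim fun _ h => order_le_of_squareAt_W9 i hi h⟩
end
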